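/- arXiv:1607.03046 — 3 statements merged into one kernel-verified Lean document; each statement's English description precedes it below -/
import Mathlib

section
/- For all n ≥ 1, the number of rooted labeled forests on [n] avoiding the pattern 321 equals the number of rooted labeled forests on [n] avoiding the pattern 312; that is, f_n(321) = f_n(312). -/
/-- A rooted labeled forest on `[n]`, encoded as a parent function
`p : Fin n → Option (Fin n)` (`p v = none` means `v` is a root).
Acyclicity is expressed by the existence of a depth function strictly
decreasing from each vertex to its parent. -/
def IsForest {n : ℕ} (p : Fin n → Option (Fin n)) : Prop :=
  ∃ d : Fin n → ℕ, ∀ v w : Fin n, p v = some w → d w < d v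

/-- `StrictAnc p a b` means `a` is a strict ancestor of `b` in the forest `p`. -/
def StrictAnc {n : ℕ} (p : Fin n → Option (Fin n)) (a b : Fin n) : Prop :=
  Relation.TransGen (fun x y : Fin n => p y = some x) a b

/-- The forest `p` contains the pattern `σ` (given in one-line notation):
there is a chain of vertices along some root-to-vertex path whose labels
are order-isomorphic to `σ`. -/
def ForestContains {n : ℕ} (p : Fin n → Option (Fin n)) (σ : List ℕ) : Prop :=
  ∃ u : Fin σ.length → Fin n,
    (∀ i j : Fin σ.length, i < j → StrictAnc p (u i) (u j)) ∧
    (∀ i j : Fin σ.length, σ.get i < σ.get j ↔ u i < u j)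

/-- The forest `p` avoids the pattern `σ`. -/
def ForestAvoids {n : ℕ} (p : Fin n → Option (Fin n)) (σ : List ℕ) : Prop :=
  ¬ ForestContains p σ

/-- Number of cycles (including fixed points) in the cycle decomposition of a
permutation. -/
def permNumCycles {n : ℕ} (π : Equiv.Perm (Fin n)) : ℕ :=
  π.cycleType.card + (Finset.univ.filter fun x => π x = x).card

/-- Unsigned Stirling number of the first kind: the number of permutations of
`[n]` with exactly `k` cycles. -/
noncomputable def stirlingFirst (n k : ℕ) : ℕ :=
  Nat.card {π : Equiv.Perm (Fin n) // permNumCycles π = k}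

/-- Stirling number of the second kind: the number of partitions of `[n]`
into `k` nonempty subsets. -/
noncomputable def stirlingSecond (n k : ℕ) : ℕ :=
  Nat.card {P : Finpartition (Finset.univ : Finset (Fin n)) // P.parts.card = k}

/-- The Bell number: the number of set partitions of `[n]`. -/
noncomputable def bellNumber (n : ℕ) : ℕ :=
  Nat.card (Finpartition (Finset.univ : Finset (Fin n)))

/-- A vertex is a top-down maximum if it is larger than all of its ancestors. -/
def IsTopDownMax {n : ℕ} (p : Fin n → Option (Fin n)) (v : Fin n) : Prop :=
  ∀ u : Fin n, StrictAnc p u v → u < v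

section Rotation

variable {β : Type*} [LinearOrder β]

/-- A cyclic rotation of a finite set: the maximum is sent to the minimum and every other element
to its successor, so that the order of the non-maximal elements is preserved. -/
structure IsRotation (V : Finset β) (c : Equiv.Perm β) : Prop where
  mem_iff : ∀ x, c x ∈ V ↔ x ∈ V
  fix : ∀ x, x ∉ V → c x = x
  max_to_min : ∀ x ∈ V, (∀ y ∈ V, y ≤ x) → ∀ y ∈ V, c x ≤ y
  mono : ∀ x ∈ V, ∀ y ∈ V, x < y → (∃ z ∈ V, y < z) → c x < c y

theorem exists_isRotation (V : Finset β) : ∃ c : Equiv.Perm β, IsRotation V c := by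
  classical
  obtain hV | ⟨k, hk⟩ : V.card = 0 ∨ ∃ k, V.card = k + 1 := by
    rcases h : V.card with _ | k
    · exact Or.inl rfl
    · exact Or.inr ⟨k, rfl⟩
  · rw [Finset.card_eq_zero] at hV
    subst hV
    exact ⟨1, by constructor <;> simp⟩
  let f := V.orderIsoOfFin hk
  let g : Equiv.Perm {x // x ∈ V} := (f.symm.toEquiv.trans (finRotate (k + 1))).trans f.toEquiv
  let c := Equiv.Perm.ofSubtype g
  have hc : ∀ i, c (f i) = f (finRotate (k + 1) i) := fun i => by
    simp [c, g, Equiv.Perm.ofSubtype_apply_coe]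
  have surj : ∀ x ∈ V, ∃ i, (f i : β) = x := fun x hx => ⟨f.symm ⟨x, hx⟩, by simp⟩
  have hlt : ∀ i j, (f i : β) < f j ↔ i < j := fun i j => by
    rw [Subtype.coe_lt_coe, f.lt_iff_lt]
  have hle : ∀ i j, (f i : β) ≤ f j ↔ i ≤ j := fun i j => by
    rw [Subtype.coe_le_coe, f.le_iff_le]
  refine ⟨c, ⟨fun x => ?_, fun x hx => Equiv.Perm.ofSubtype_apply_of_not_mem g hx, ?_, ?_⟩⟩
  · by_cases hx : x ∈ V
    · obtain ⟨i, rfl⟩ := surj x hx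
      simp [hc]
    · rw [Equiv.Perm.ofSubtype_apply_of_not_mem g hx]
  · intro x hx hmax y hy
    obtain ⟨i, rfl⟩ := surj x hx
    obtain ⟨j, rfl⟩ := surj y hy
    have hi : i = Fin.last k := le_antisymm (Fin.le_last i)
      ((hle _ _).1 (hmax _ (f (Fin.last k)).2))
    rw [hc, hle, hi, finRotate_last]
    exact Fin.zero_le j
  · rintro x hx y hy hxy ⟨z, hz, hyz⟩
    obtain ⟨i, rfl⟩ := surj x hx
    obtain ⟨j, rfl⟩ := surj y hy
    obtain ⟨l, rfl⟩ := surj z hz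
    rw [hlt] at hxy hyz
    have hj : j ≠ Fin.last k := (hyz.trans_le (Fin.le_last l)).ne
    have hi : i ≠ Fin.last k := (hxy.trans (hyz.trans_le (Fin.le_last l))).ne
    rw [hc, hc, hlt, Fin.lt_def, coe_finRotate_of_ne_last hi, coe_finRotate_of_ne_last hj]
    exact Nat.succ_lt_succ hxy

namespace IsRotation

variable {V : Finset β} {c : Equiv.Perm β}

theorem symm_mem_iff (h : IsRotation V c) (x : β) : c.symm x ∈ V ↔ x ∈ V := by
  simpa using (h.mem_iff (c.symm x)).symm

theorem symm_fix (h : IsRotation V c) (x : β) (hx : x ∉ V) : c.symm x = x := by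
  rw [Equiv.symm_apply_eq, h.fix x hx]

theorem symm_min_to_max (h : IsRotation V c) (x : β) (hx : x ∈ V) (hmin : ∀ y ∈ V, x ≤ y) :
    ∀ y ∈ V, y ≤ c.symm x := by
  have hne : V.Nonempty := ⟨x, hx⟩
  have hm := h.max_to_min (V.max' hne) (V.max'_mem hne) (fun y hy => V.le_max' y hy) x hx
  have hxm : c (V.max' hne) = x :=
    le_antisymm hm (hmin _ ((h.mem_iff _).2 (V.max'_mem hne)))
  rw [← hxm, Equiv.symm_apply_apply]
  exact fun y hy => V.le_max' y hy

theorem symm_mono (h : IsRotation V c) (x : β) (hx : x ∈ V) (y : β) (hy : y ∈ V) (hxy : x < y)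
    (hz : ∃ z ∈ V, z < x) : c.symm x < c.symm y := by
  obtain ⟨z, hz, hzx⟩ := hz
  by_contra hlt
  have hne : c.symm x ≠ c.symm y := fun e => hxy.ne (c.symm.injective e)
  have hlt' : c.symm y < c.symm x := lt_of_le_of_ne (not_lt.1 hlt) hne.symm
  have hx' := (h.symm_mem_iff x).2 hx
  have hy' := (h.symm_mem_iff y).2 hy
  have hnotmax : ∃ t ∈ V, c.symm x < t := by
    by_contra! hmax
    have := h.max_to_min _ hx' hmax z hz
    rw [Equiv.apply_symm_apply] at this
    exact absurd hzx (not_lt.2 this)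
  have := h.mono _ hy' _ hx' hlt' hnotmax
  rw [Equiv.apply_symm_apply, Equiv.apply_symm_apply] at this
  exact absurd hxy this.asymm

end IsRotation

end Rotation

section Labelings

variable {α β : Type*} [LinearOrder β]

/-- The condition that the vertex `v` is not the middle of a `312` (if `v ∈ S`) or of a `321`
(if `v ∉ S`) in the labeling `a`, where `r` is the strict ancestor relation. -/
def AvoidsAt (r : α → α → Prop) (S : Finset α) (a : α ≃ β) (v : α) : Prop :=
  ∀ u w, r u v → r v w →
    (v ∈ S → ¬(a v < a w ∧ a w < a u)) ∧ (v ∉ S → ¬(a w < a v ∧ a v < a u))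

theorem avoidsAt_insert [DecidableEq α] {r : α → α → Prop} {v : α} {a : α ≃ β}
    {S : Finset α} {x : α} (hxv : x ≠ v) :
    AvoidsAt r (insert v S) a x ↔ AvoidsAt r S a x := by
  simp [AvoidsAt, hxv]

open Classical in
/-- The labels on weak descendants of `v` that are smaller than some label above `v`; empty when
`v` is itself larger than all its ancestors. -/
noncomputable def lowLabels [Fintype β] (r : α → α → Prop) (v : α) (a : α ≃ β) : Finset β :=
  Finset.univ.filter fun y =>
    (a.symm y = v ∨ r v (a.symm y)) ∧ (∃ u, r u v ∧ y < a u) ∧ ∃ u, r u v ∧ a v < a u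

variable [Fintype β] {r : α → α → Prop} {v : α} {a : α ≃ β} {e : Equiv.Perm β}

theorem mem_lowLabels_apply {w : α} : a w ∈ lowLabels r v a ↔
    (w = v ∨ r v w) ∧ (∃ u, r u v ∧ a w < a u) ∧ ∃ u, r u v ∧ a v < a u := by
  simp [lowLabels]

theorem lowLabels_trans [IsStrictOrder α r]
    (hmem : ∀ x, e x ∈ lowLabels r v a ↔ x ∈ lowLabels r v a)
    (hfix : ∀ x, x ∉ lowLabels r v a → e x = x) :
    lowLabels r v (a.trans e) = lowLabels r v a := by
  have hup : ∀ u, r u v → e (a u) = a u := fun u hu => hfix _ fun h => by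
    rcases (mem_lowLabels_apply.1 h).1 with rfl | h'
    · exact irrefl_of r _ hu
    · exact irrefl_of r _ (trans_of r hu h')
  ext y
  obtain ⟨w, rfl⟩ := (a.trans e).surjective y
  rw [mem_lowLabels_apply, Equiv.trans_apply, hmem]
  constructor
  · rintro ⟨hw, ⟨u, hu, hwu⟩, ⟨t, ht, hvt⟩⟩
    by_contra hn
    simp only [Equiv.trans_apply, hup u hu, hfix _ hn, hup t ht] at hwu hvt
    refine hn (mem_lowLabels_apply.2 ⟨hw, ⟨u, hu, hwu⟩, ?_⟩)
    by_cases hv : a v ∈ lowLabels r v a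
    · exact (mem_lowLabels_apply.1 hv).2.2
    · exact ⟨t, ht, by rwa [hfix _ hv] at hvt⟩
  · intro h
    have key : ∀ x, a x ∈ lowLabels r v a → ∃ u, r u v ∧ (a.trans e) x < (a.trans e) u := by
      intro x hx
      have h1 := (hmem _).2 hx
      obtain ⟨z, hz⟩ := a.surjective (e (a x))
      rw [← hz, mem_lowLabels_apply] at h1
      obtain ⟨u, hu, hlt⟩ := h1.2.1
      exact ⟨u, hu, by rw [Equiv.trans_apply, Equiv.trans_apply, hup u hu, ← hz]; exact hlt⟩
    have h' := mem_lowLabels_apply.1 h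
    exact ⟨h'.1, key w h, key v (mem_lowLabels_apply.2 ⟨Or.inl rfl, h'.2.2, h'.2.2⟩)⟩

theorem avoidsAt_trans [IsStrictOrder α r] {S : Finset α}
    (hchain : ∀ u v x, r u x → r v x → u = v ∨ r u v ∨ r v u)
    (hS : ∀ u x, r u x → x ∈ S → u ∈ S) (hvS : v ∉ S) (hup : ∀ u, r u v → u ∈ S)
    (hmem : ∀ x, e x ∈ lowLabels r v a ↔ x ∈ lowLabels r v a)
    (hfix : ∀ x, x ∉ lowLabels r v a → e x = x)
    (hmono : ∀ x ∈ lowLabels r v a, ∀ y ∈ lowLabels r v a, x ≠ a v → y ≠ a v → x < y → e x < e y)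
    {x : α} (hxv : x ≠ v) (h : AvoidsAt r S a x) : AvoidsAt r S (a.trans e) x := by
  have hirr : ∀ x, ¬ r x x := irrefl_of r
  have htr : ∀ {x y z}, r x y → r y z → r x z := fun h h' => trans_of r h h'
  have hlow : ∀ w, ¬(w = v ∨ r v w) → e (a w) = a w := fun w hw =>
    hfix _ fun h => hw (mem_lowLabels_apply.1 h).1
  intro u w hux hxw
  simp only [Equiv.trans_apply]
  refine ⟨fun hxS => ?_, fun hxS => ?_⟩
  · have hvx : ¬ r v x := fun h => hvS (hS _ _ h hxS)
    have hvu : ¬(u = v ∨ r v u) := by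
      rintro (rfl | h)
      · exact hvx hux
      · exact hvx (htr h hux)
    rw [hlow x (by tauto), hlow u hvu]
    by_cases hw : a w ∈ lowLabels r v a
    · have hxv' : r x v := by
        rcases (mem_lowLabels_apply.1 hw).1 with rfl | hvw
        · exact hxw
        · rcases hchain _ _ _ hxw hvw with h | h | h
          · exact absurd h hxv
          · exact h
          · exact absurd h hvx
      have hew := (hmem _).2 hw
      obtain ⟨z, hz⟩ := a.surjective (e (a w))
      rw [← hz] at hew ⊢
      refine (h u z hux ?_).1 hxS
      rcases (mem_lowLabels_apply.1 hew).1 with rfl | hvz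
      · exact hxv'
      · exact htr hxv' hvz
    · rw [hfix _ hw]
      exact (h u w hux hxw).1 hxS
  · have hxv' : ¬ r x v := fun h => hxS (hup _ h)
    by_cases hvx : r v x
    · rintro ⟨hwx, hxu⟩
      have hvw : r v w := htr hvx hxw
      have hwv : w ≠ v := fun h => hirr v (h ▸ hvw)
      have nmem : ∀ y, r v y → ∀ t, t ∈ lowLabels r v a → a y ∉ lowLabels r v a → t < a y := by
        intro y hy t ht hny
        obtain ⟨z, rfl⟩ := a.surjective t
        obtain ⟨-, ⟨p, hp, hlt⟩, hM⟩ := mem_lowLabels_apply.1 ht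
        by_contra hle
        exact hny (mem_lowLabels_apply.2 ⟨Or.inr hy, ⟨p, hp, (not_lt.1 hle).trans_lt hlt⟩, hM⟩)
      have hawx : a w < a x := by
        by_contra hle
        have hne : a w ≠ a x := fun h => hirr x (a.injective h ▸ hxw)
        have hlt : a x < a w := lt_of_le_of_ne (not_lt.1 hle) hne.symm
        by_cases hw : a w ∈ lowLabels r v a <;> by_cases hx : a x ∈ lowLabels r v a
        · exact absurd hwx (hmono _ hx _ hw (fun h => hxv (a.injective h))
            (fun h => hwv (a.injective h)) hlt).asymm
        · exact absurd hlt (nmem x hvx _ hw hx).asymm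
        · have := nmem w hvw _ ((hmem _).2 hx) hw
          rw [hfix _ hw] at hwx
          exact absurd hwx this.asymm
        · rw [hfix _ hw, hfix _ hx] at hwx
          exact hle hwx
      by_cases hx : a x ∈ lowLabels r v a
      · obtain ⟨-, ⟨p, hp, hlt⟩, -⟩ := mem_lowLabels_apply.1 hx
        exact (h p w (htr hp hvx) hxw).2 hxS ⟨hawx, hlt⟩
      · rw [hfix _ hx] at hxu
        by_cases hu : a u ∈ lowLabels r v a
        · exact absurd hxu (nmem x hvx _ ((hmem _).2 hu) hx).asymm
        · rw [hfix _ hu] at hxu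
          exact (h u w hux hxw).2 hxS ⟨hawx, hxu⟩
    · have hvu : ¬(u = v ∨ r v u) := by
        rintro (rfl | h)
        · exact hvx hux
        · exact hvx (htr h hux)
      have hvw : ¬(w = v ∨ r v w) := by
        rintro (rfl | h)
        · exact hxv' hxw
        · rcases hchain _ _ _ hxw h with h | h | h <;> tauto
      rw [hlow x (by tauto), hlow u hvu, hlow w hvw]
      exact (h u w hux hxw).2 hxS

theorem apply_le_of_mem_lowLabels {S : Finset α} (hvS : v ∉ S) (h : AvoidsAt r S a v)
    {y : β} (hy : y ∈ lowLabels r v a) : a v ≤ y := by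
  obtain ⟨w, rfl⟩ := a.surjective y
  obtain ⟨rfl | hw, -, u, hu, hlt⟩ := mem_lowLabels_apply.1 hy
  · exact le_rfl
  · by_contra hn
    exact (h u w hu hw).2 hvS ⟨not_le.1 hn, hlt⟩

theorem le_apply_of_mem_lowLabels {S : Finset α} (hvS : v ∈ S) (h : AvoidsAt r S a v)
    {y : β} (hy : y ∈ lowLabels r v a) : y ≤ a v := by
  obtain ⟨w, rfl⟩ := a.surjective y
  obtain ⟨rfl | hw, ⟨u, hu, hlt⟩, -⟩ := mem_lowLabels_apply.1 hy
  · exact le_rfl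
  · by_contra hn
    exact (h u w hu hw).1 hvS ⟨not_le.1 hn, hlt⟩

theorem mem_lowLabels_of_lt {u w : α} (hu : r u v) (hw : r v w) (hv : a v < a u)
    (hwu : a w < a u) : a w ∈ lowLabels r v a ∧ a v ∈ lowLabels r v a :=
  ⟨mem_lowLabels_apply.2 ⟨Or.inr hw, ⟨u, hu, hwu⟩, u, hu, hv⟩,
    mem_lowLabels_apply.2 ⟨Or.inl rfl, ⟨u, hu, hv⟩, u, hu, hv⟩⟩

theorem self_mem_lowLabels {y : β} (hy : y ∈ lowLabels r v a) : a v ∈ lowLabels r v a := by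
  obtain ⟨w, rfl⟩ := a.surjective y
  obtain ⟨-, -, h⟩ := mem_lowLabels_apply.1 hy
  exact mem_lowLabels_apply.2 ⟨Or.inl rfl, h, h⟩

theorem card_avoidsAt_insert [DecidableEq α] [IsStrictOrder α r] {S : Finset α}
    (hchain : ∀ u v x, r u x → r v x → u = v ∨ r u v ∨ r v u)
    (hS : ∀ u x, r u x → x ∈ S → u ∈ S) (hvS : v ∉ S) (hup : ∀ u, r u v → u ∈ S) :
    Nat.card {a : α ≃ β // ∀ x, AvoidsAt r S a x} =
      Nat.card {a : α ≃ β // ∀ x, AvoidsAt r (insert v S) a x} := by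
  choose c hc using exists_isRotation (β := β)
  have hF : ∀ a : α ≃ β, lowLabels r v (a.trans (c (lowLabels r v a)).symm) = lowLabels r v a :=
    fun a => lowLabels_trans (hc _).symm_mem_iff (hc _).symm_fix
  have hG : ∀ a : α ≃ β, lowLabels r v (a.trans (c (lowLabels r v a))) = lowLabels r v a :=
    fun a => lowLabels_trans (hc _).mem_iff (hc _).fix
  refine Nat.card_congr
    { toFun := fun a => ⟨a.1.trans (c (lowLabels r v a.1)).symm, fun x => ?_⟩
      invFun := fun a => ⟨a.1.trans (c (lowLabels r v a.1)), fun x => ?_⟩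
      left_inv := fun a => ?_
      right_inv := fun a => ?_ }
  · obtain ⟨a, ha⟩ := a
    by_cases hxv : x = v
    · subst hxv
      intro u w hu hw
      refine ⟨fun _ ⟨h1, h2⟩ => ?_, fun h => absurd (Finset.mem_insert_self _ _) h⟩
      obtain ⟨h3, h4⟩ := mem_lowLabels_of_lt hu hw (h1.trans h2) h2
      rw [hF] at h3 h4
      rw [Equiv.trans_apply, (hc _).symm_mem_iff] at h4
      exact absurd h1 (not_lt.2 ((hc _).symm_min_to_max _ h4
        (fun y hy => apply_le_of_mem_lowLabels hvS (ha x) hy) _ h3))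
    · rw [avoidsAt_insert hxv]
      refine avoidsAt_trans hchain hS hvS hup (hc _).symm_mem_iff (hc _).symm_fix ?_ hxv (ha x)
      exact fun y hy z hz hyv _ hlt => (hc _).symm_mono y hy z hz hlt
        ⟨a v, self_mem_lowLabels hy,
          lt_of_le_of_ne (apply_le_of_mem_lowLabels hvS (ha v) hy) hyv.symm⟩
  · obtain ⟨a, ha⟩ := a
    by_cases hxv : x = v
    · subst hxv
      intro u w hu hw
      refine ⟨fun h => absurd h hvS, fun _ ⟨h1, h2⟩ => ?_⟩
      obtain ⟨h3, h4⟩ := mem_lowLabels_of_lt hu hw h2 (h1.trans h2)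
      rw [hG] at h3 h4
      rw [Equiv.trans_apply, (hc _).mem_iff] at h4
      exact absurd h1 (not_lt.2 ((hc _).max_to_min _ h4 (fun y hy =>
        le_apply_of_mem_lowLabels (Finset.mem_insert_self _ _) (ha x) hy) _ h3))
    · refine avoidsAt_trans hchain hS hvS hup (hc _).mem_iff (hc _).fix ?_ hxv
        ((avoidsAt_insert hxv).1 (ha x))
      exact fun y hy z hz _ hzv hlt => (hc _).mono y hy z hz hlt
        ⟨a v, self_mem_lowLabels hy, lt_of_le_of_ne
          (le_apply_of_mem_lowLabels (Finset.mem_insert_self _ _) (ha v) hz) hzv⟩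
  · ext x
    simp [hF]
  · ext x
    simp [hG]

theorem card_avoidsAt_eq [DecidableEq α] [IsStrictOrder α r]
    (hchain : ∀ u v x, r u x → r v x → u = v ∨ r u v ∨ r v u) (S : Finset α)
    (hS : ∀ u x, r u x → x ∈ S → u ∈ S) :
    Nat.card {a : α ≃ β // ∀ x, AvoidsAt r S a x} =
      Nat.card {a : α ≃ β // ∀ x, AvoidsAt r ∅ a x} := by
  induction S using Finset.strongInduction with
  | H S ih =>
    rcases S.eq_empty_or_nonempty with rfl | hne
    · rfl
    obtain ⟨v, hv, hmax⟩ : ∃ v ∈ S, ∀ x ∈ S, ¬ r v x := by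
      obtain ⟨v, -, hv⟩ := (Finite.wellFounded_of_trans_of_irrefl
        (fun x y : S => r y.1 x.1)).has_min Set.univ ⟨⟨_, hne.choose_spec⟩, trivial⟩
      exact ⟨v, v.2, fun x hx => hv ⟨x, hx⟩ trivial⟩
    have hS' : ∀ u x, r u x → x ∈ S.erase v → u ∈ S.erase v := fun u x hux hx => by
      rw [Finset.mem_erase] at hx ⊢
      exact ⟨fun h => hmax x hx.2 (h ▸ hux), hS u x hux hx.2⟩
    rw [← ih _ (Finset.erase_ssubset hv) hS',
      card_avoidsAt_insert hchain hS' (Finset.notMem_erase v S), Finset.insert_erase hv]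
    intro u hu
    exact Finset.mem_erase.2 ⟨fun h => irrefl_of r v (h ▸ hu), hS u v hu hv⟩

end Labelings

section Forests

variable {n : ℕ}

theorem IsForest.isStrictOrder {p : Fin n → Option (Fin n)} (h : IsForest p) :
    IsStrictOrder (Fin n) (StrictAnc p) := by
  obtain ⟨d, hd⟩ := h
  have hlt : ∀ {x y}, StrictAnc p x y → d x < d y := fun h => by
    induction h with
    | single h => exact hd _ _ h
    | tail _ h ih => exact ih.trans (hd _ _ h)
  exact { irrefl := fun x hx => (hlt hx).false
          trans := fun _ _ _ => Relation.TransGen.trans }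

theorem StrictAnc.comparable {p : Fin n → Option (Fin n)} {u v x : Fin n}
    (hu : StrictAnc p u x) (hv : StrictAnc p v x) : u = v ∨ StrictAnc p u v ∨ StrictAnc p v u := by
  have hunique : Relator.LeftUnique fun x y : Fin n => p y = some x := fun a b c h h' =>
    Option.some.inj (h.symm.trans h')
  induction hu with
  | single h =>
    rcases Relation.TransGen.tail'_iff.1 hv with ⟨y, hvy, hy⟩
    rw [hunique h hy]
    rcases Relation.reflTransGen_iff_eq_or_transGen.1 hvy with rfl | hlt
    · exact Or.inl rfl
    · exact Or.inr (Or.inr hlt)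
  | tail hub h ih =>
    rcases Relation.TransGen.tail'_iff.1 hv with ⟨y, hvy, hy⟩
    rw [← hunique h hy] at hvy
    rcases Relation.reflTransGen_iff_eq_or_transGen.1 hvy with rfl | hlt
    · exact Or.inr (Or.inl hub)
    · exact ih hlt

/-- The forest obtained from `p` by relabeling its vertices along `a`. -/
def relabel (a : Equiv.Perm (Fin n)) (p : Fin n → Option (Fin n)) : Fin n → Option (Fin n) :=
  fun v => (p (a.symm v)).map a

theorem relabel_eq_some {a : Equiv.Perm (Fin n)} {p : Fin n → Option (Fin n)} {x y : Fin n} :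
    relabel a p (a y) = some (a x) ↔ p y = some x := by
  simp [relabel]

theorem relabel_symm_relabel (a : Equiv.Perm (Fin n)) (p : Fin n → Option (Fin n)) :
    relabel a.symm (relabel a p) = p := by
  funext v
  simp [relabel]

theorem IsForest.relabel {p : Fin n → Option (Fin n)} (h : IsForest p)
    (a : Equiv.Perm (Fin n)) : IsForest (relabel a p) := by
  obtain ⟨d, hd⟩ := h
  refine ⟨d ∘ a.symm, fun v w hvw => ?_⟩
  obtain ⟨y, rfl⟩ := a.surjective v
  obtain ⟨x, rfl⟩ := a.surjective w
  simpa using hd y x (relabel_eq_some.1 hvw)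

theorem StrictAnc.relabel {p : Fin n → Option (Fin n)} {x y : Fin n} (h : StrictAnc p x y)
    (a : Equiv.Perm (Fin n)) : StrictAnc (relabel a p) (a x) (a y) :=
  h.lift (p := fun x y => _root_.relabel a p y = some x) a fun _ _ h => relabel_eq_some.2 h

theorem strictAnc_relabel_iff {p : Fin n → Option (Fin n)} {x y : Fin n}
    {a : Equiv.Perm (Fin n)} : StrictAnc (relabel a p) (a x) (a y) ↔ StrictAnc p x y := by
  refine ⟨fun h => ?_, fun h => h.relabel a⟩
  simpa [relabel_symm_relabel] using h.relabel a.symm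

theorem forestAvoids_321_iff {p : Fin n → Option (Fin n)} : ForestAvoids p [3, 2, 1] ↔
    ∀ u v w, StrictAnc p u v → StrictAnc p v w → ¬(w < v ∧ v < u) := by
  constructor
  · rintro h u v w huv hvw ⟨h1, h2⟩
    refine h ⟨![u, v, w], ?_, ?_⟩
    · have := huv.trans hvw
      intro i j hij
      fin_cases i <;> fin_cases j <;> simp_all [StrictAnc]
    · intro i j
      have := h1.trans h2
      fin_cases i <;> fin_cases j <;> simp_all [le_of_lt]
  · rintro h ⟨u, hu, hlt⟩
    exact h (u 0) (u 1) (u 2) (hu 0 1 (by decide)) (hu 1 2 (by decide))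
      ⟨(hlt 2 1).1 (by decide), (hlt 1 0).1 (by decide)⟩

theorem forestAvoids_312_iff {p : Fin n → Option (Fin n)} : ForestAvoids p [3, 1, 2] ↔
    ∀ u v w, StrictAnc p u v → StrictAnc p v w → ¬(v < w ∧ w < u) := by
  constructor
  · rintro h u v w huv hvw ⟨h1, h2⟩
    refine h ⟨![u, v, w], ?_, ?_⟩
    · have := huv.trans hvw
      intro i j hij
      fin_cases i <;> fin_cases j <;> simp_all [StrictAnc]
    · intro i j
      have := h1.trans h2
      fin_cases i <;> fin_cases j <;> simp_all [le_of_lt]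
  · rintro h ⟨u, hu, hlt⟩
    exact h (u 0) (u 1) (u 2) (hu 0 1 (by decide)) (hu 1 2 (by decide))
      ⟨(hlt 1 2).1 (by decide), (hlt 2 0).1 (by decide)⟩

theorem forall_avoidsAt_empty_iff {p : Fin n → Option (Fin n)} {a : Equiv.Perm (Fin n)} :
    (∀ x, AvoidsAt (StrictAnc p) ∅ a x) ↔ ForestAvoids (relabel a p) [3, 2, 1] := by
  rw [forestAvoids_321_iff]
  constructor
  · intro h u v w huv hvw
    obtain ⟨u, rfl⟩ := a.surjective u
    obtain ⟨v, rfl⟩ := a.surjective v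
    obtain ⟨w, rfl⟩ := a.surjective w
    exact (h v u w (strictAnc_relabel_iff.1 huv) (strictAnc_relabel_iff.1 hvw)).2 (Finset.notMem_empty v)
  · intro h v u w huv hvw
    exact ⟨fun hv => absurd hv (Finset.notMem_empty v), fun _ => h _ _ _ (huv.relabel a) (hvw.relabel a)⟩

theorem forall_avoidsAt_univ_iff {p : Fin n → Option (Fin n)} {a : Equiv.Perm (Fin n)} :
    (∀ x, AvoidsAt (StrictAnc p) Finset.univ a x) ↔ ForestAvoids (relabel a p) [3, 1, 2] := by
  rw [forestAvoids_312_iff]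
  constructor
  · intro h u v w huv hvw
    obtain ⟨u, rfl⟩ := a.surjective u
    obtain ⟨v, rfl⟩ := a.surjective v
    obtain ⟨w, rfl⟩ := a.surjective w
    exact (h v u w (strictAnc_relabel_iff.1 huv) (strictAnc_relabel_iff.1 hvw)).1 (Finset.mem_univ v)
  · intro h v u w huv hvw
    exact ⟨fun _ => h _ _ _ (huv.relabel a) (hvw.relabel a), fun hv => absurd (Finset.mem_univ v) hv⟩

/-- Pairs of a permutation and a `σ`-avoiding forest correspond to forests together with a
relabeling that makes them `σ`-avoiding. -/
def permProdAvoidingEquiv (n : ℕ) (σ : List ℕ) :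
    Equiv.Perm (Fin n) × {p : Fin n → Option (Fin n) // IsForest p ∧ ForestAvoids p σ} ≃
      Σ p : {p : Fin n → Option (Fin n) // IsForest p},
        {a : Equiv.Perm (Fin n) // ForestAvoids (relabel a p.1) σ} where
  toFun x := ⟨⟨relabel x.1.symm x.2.1, x.2.2.1.relabel _⟩, x.1, by
    have := relabel_symm_relabel x.1.symm x.2.1
    rw [Equiv.symm_symm] at this
    exact this.symm ▸ x.2.2.2⟩
  invFun x := ⟨x.2.1, relabel x.2.1 x.1.1, x.1.2.relabel _, x.2.2⟩
  left_inv x := by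
    have := relabel_symm_relabel x.1.symm x.2.1
    rw [Equiv.symm_symm] at this
    exact Prod.ext rfl (Subtype.ext this)
  right_inv x := by
    obtain ⟨⟨p, hp⟩, a, ha⟩ := x
    refine Sigma.subtype_ext ?_ rfl
    exact Subtype.ext (relabel_symm_relabel a p)

end Forests

theorem forest_wilf_321_312 (n : ℕ) (hn : 1 ≤ n) :
    Nat.card {p : Fin n → Option (Fin n) // IsForest p ∧ ForestAvoids p [3, 2, 1]} =
    Nat.card {p : Fin n → Option (Fin n) // IsForest p ∧ ForestAvoids p [3, 1, 2]} := by
  refine Nat.eq_of_mul_eq_mul_left (Nat.card_pos (α := Equiv.Perm (Fin n))) ?_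
  rw [← Nat.card_prod, ← Nat.card_prod, Nat.card_congr (permProdAvoidingEquiv n [3, 2, 1]),
    Nat.card_congr (permProdAvoidingEquiv n [3, 1, 2])]
  classical
  rw [Nat.card_sigma, Nat.card_sigma]
  refine Finset.sum_congr rfl fun p _ => ?_
  have := p.2.isStrictOrder
  have h := card_avoidsAt_eq (β := Fin n) (r := StrictAnc p.1) (fun _ _ _ => StrictAnc.comparable (p := p.1))
    Finset.univ (fun _ _ _ _ => Finset.mem_univ _)
  simp only [forall_avoidsAt_empty_iff, forall_avoidsAt_univ_iff] at h
  exact h.symm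
end

section
/- For all n ≥ 1, the number of rooted labeled forests on [n] avoiding both patterns 312 and 213 equals ∑_{k=1}^{n} k!·c(n,k), where c(n,k) is the unsigned Stirling number of the first kind. -/
open Equiv Polynomial

section Cycles

variable {α : Type*} [Fintype α] [DecidableEq α]

theorem Equiv.Perm.card_and_sum_cycleType_swap_mul_of_moved {σ : Perm α} {x y : α} (hy : σ y = y)
    (hx : σ x ≠ x) :
    (swap y x * σ).cycleType.card = σ.cycleType.card ∧
      (swap y x * σ).cycleType.sum = σ.cycleType.sum + 1 := by
  obtain ⟨l, hl⟩ : ∃ l, Perm.toList σ x = x :: l := by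
    have hpos := Perm.length_toList_pos_of_mem_support _ _ (Perm.mem_support.2 hx)
    have hzero := Perm.toList_getElem_zero _ _ (Perm.mem_support.2 hx)
    cases h : Perm.toList σ x with
    | nil => simp [h] at hpos
    | cons a l => simp only [h, List.getElem_cons_zero] at hzero; exact ⟨l, by rw [hzero]⟩
  have hform : (y :: x :: l).formPerm = swap y x * σ.cycleOf x := by
    rw [List.formPerm_cons_cons, ← hl, Perm.formPerm_toList]
  have hyl : y ∉ x :: l := by
    rw [← hl, Perm.mem_toList_iff]
    rintro ⟨hsame, -⟩
    exact hx ((hsame.apply_eq_self_iff).2 hy)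
  have hnodup : (y :: x :: l).Nodup :=
    List.nodup_cons.2 ⟨hyl, hl ▸ Perm.nodup_toList σ x⟩
  have hcycle : (swap y x * σ.cycleOf x).IsCycle :=
    hform ▸ List.isCycle_formPerm hnodup (by simp)
  have hsupp : (swap y x * σ.cycleOf x).support = insert y (σ.cycleOf x).support := by
    rw [← hform, List.support_formPerm_of_nodup _ hnodup (by simp), List.toFinset_cons, ← hl,
      ← Perm.formPerm_toList, List.support_formPerm_of_nodup _ (Perm.nodup_toList σ x)
        (fun z => Perm.toList_ne_singleton _ _ z)]
  have hdisj : Perm.Disjoint (σ * (σ.cycleOf x)⁻¹) (σ.cycleOf x) :=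
    Perm.disjoint_mul_inv_of_mem_cycleFactorsFinset
      (Perm.cycleOf_mem_cycleFactorsFinset_iff.2 (Perm.mem_support.2 hx))
  have hcy : σ.cycleOf x y = y :=
    Perm.cycleOf_apply_of_not_sameCycle fun h => hx (h.apply_eq_self_iff.2 hy)
  have hcy' : (σ.cycleOf x)⁻¹ y = y := by rw [Perm.inv_eq_iff_eq, hcy]
  have hry : (σ * (σ.cycleOf x)⁻¹) y = y := by rw [Perm.mul_apply, hcy', hy]
  have hdisj' : Perm.Disjoint (swap y x * σ.cycleOf x) (σ * (σ.cycleOf x)⁻¹) := by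
    rw [Perm.disjoint_iff_disjoint_support] at hdisj ⊢
    rw [hsupp, Finset.disjoint_insert_left]
    exact ⟨by simpa using hry, hdisj.symm⟩
  have hσ : σ = σ.cycleOf x * (σ * (σ.cycleOf x)⁻¹) := by
    rw [← hdisj.commute.eq]; group
  have h1 : σ.cycleType = (σ.cycleOf x).cycleType + (σ * (σ.cycleOf x)⁻¹).cycleType := by
    rw [← hdisj.symm.cycleType_mul, ← hσ]
  have h2 : (swap y x * σ).cycleType =
      (swap y x * σ.cycleOf x).cycleType + (σ * (σ.cycleOf x)⁻¹).cycleType := by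
    rw [← hdisj'.cycleType_mul, mul_assoc, ← hσ]
  rw [h1, h2, hcycle.cycleType, (Perm.isCycle_cycleOf σ hx).cycleType, hsupp,
    Finset.card_insert_of_notMem (by simpa using hcy)]
  simp
  omega

theorem Equiv.Perm.cycleType_swap_mul_of_fixed {σ : Perm α} {x y : α} (hxy : y ≠ x)
    (hy : σ y = y) (hx : σ x = x) : (swap y x * σ).cycleType = 2 ::ₘ σ.cycleType := by
  have hdisj : Perm.Disjoint (swap y x) σ := by
    rw [Perm.disjoint_iff_disjoint_support, Perm.support_swap hxy]
    simp [hx, hy]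
  rw [hdisj.cycleType_mul, (Perm.isCycle_swap hxy).cycleType, Perm.support_swap hxy,
    Finset.card_pair hxy]
  simp

end Cycles

theorem permNumCycles_add_sum_cycleType {n : ℕ} (σ : Perm (Fin n)) :
    permNumCycles σ + σ.cycleType.sum = σ.cycleType.card + n := by
  have h : (Finset.univ.filter fun x => σ x = x) = σ.supportᶜ := by ext; simp
  have h' := Finset.card_add_card_compl σ.support
  rw [permNumCycles, h, Perm.sum_cycleType]
  simp only [Fintype.card_fin] at h'
  omega

theorem permNumCycles_swap_mul {n : ℕ} {σ : Perm (Fin n)} {x y : Fin n} (hxy : y ≠ x)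
    (hy : σ y = y) : permNumCycles (swap y x * σ) + 1 = permNumCycles σ := by
  have h1 := permNumCycles_add_sum_cycleType σ
  have h2 := permNumCycles_add_sum_cycleType (swap y x * σ)
  by_cases hx : σ x = x
  · rw [Perm.cycleType_swap_mul_of_fixed hxy hy hx] at h2
    simp only [Multiset.sum_cons, Multiset.card_cons] at h2
    omega
  · obtain ⟨h3, h4⟩ := Perm.card_and_sum_cycleType_swap_mul_of_moved hy hx
    omega

theorem permNumCycles_decomposeFin_symm_zero {n : ℕ} (e : Perm (Fin n)) :
    permNumCycles (Perm.decomposeFin.symm (0, e)) = permNumCycles e + 1 := by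
  have h : Perm.decomposeFin.symm (0, e) = e.extendDomain (finSuccAboveEquiv 0) := by
    ext i
    refine Fin.cases ?_ (fun j => ?_) i
    · rw [Perm.extendDomain_apply_not_subtype _ _ (by simp)]
      simp
    · have := Perm.extendDomain_apply_image e (finSuccAboveEquiv 0) j
      simp only [finSuccAboveEquiv_apply, Fin.succAbove_zero] at this
      rw [this]
      simp
  have h1 := permNumCycles_add_sum_cycleType e
  have h2 := permNumCycles_add_sum_cycleType (Perm.decomposeFin.symm (0, e))
  rw [h, Perm.cycleType_extendDomain] at h2
  rw [h]
  omega

theorem permNumCycles_decomposeFin_symm_succ {n : ℕ} (i : Fin n) (e : Perm (Fin n)) :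
    permNumCycles (Perm.decomposeFin.symm (i.succ, e)) = permNumCycles e := by
  have h : Perm.decomposeFin.symm (i.succ, e) = swap 0 i.succ * Perm.decomposeFin.symm (0, e) := by
    ext j
    refine Fin.cases ?_ (fun k => ?_) j <;> simp
  have h1 := permNumCycles_swap_mul (σ := Perm.decomposeFin.symm (0, e))
    (Fin.succ_ne_zero i).symm (by simp)
  rw [← h, permNumCycles_decomposeFin_symm_zero] at h1
  omega

theorem sum_X_pow_permNumCycles (n : ℕ) :
    ∑ σ : Perm (Fin n), (X : ℕ[X]) ^ permNumCycles σ = ∏ i : Fin n, (X + C (i : ℕ)) := by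
  induction n with
  | zero => simp [permNumCycles]
  | succ n ih =>
    rw [← Perm.decomposeFin.symm.sum_comp, Fintype.sum_prod_type, Fin.sum_univ_succ]
    simp only [permNumCycles_decomposeFin_symm_zero, permNumCycles_decomposeFin_symm_succ]
    rw [Fin.prod_univ_castSucc]
    simp only [Fin.val_castSucc, Fin.val_last, Finset.sum_const, Finset.card_univ,
      Fintype.card_fin, pow_succ, ← Finset.sum_mul, ih]
    have hC : (C n : ℕ[X]) = n := C_eq_natCast n
    rw [nsmul_eq_mul, hC]
    ring

theorem stirlingFirst_eq_sum_prod (n k : ℕ) :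
    stirlingFirst n k =
      ∑ S ∈ Finset.univ.filter (fun S : Finset (Fin n) => S.card = k),
        ∏ v ∈ Sᶜ, (n - 1 - (v : ℕ)) := by
  have h := congrArg (fun P : ℕ[X] => P.coeff k) (sum_X_pow_permNumCycles n)
  have hrev : ∏ i : Fin n, ((X : ℕ[X]) + C (i : ℕ)) =
      ∏ v : Fin n, (X + C (n - 1 - (v : ℕ))) := by
    rw [← Equiv.prod_comp Fin.revPerm]
    refine Finset.prod_congr rfl fun i _ => ?_
    have : (Fin.revPerm i : ℕ) = n - 1 - i := by
      simp only [Fin.revPerm_apply, Fin.val_rev]; omega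
    rw [this]
  have hcoeff (S : Finset (Fin n)) :
      ((∏ _v ∈ S, (X : ℕ[X])) * ∏ v ∈ Finset.univ \ S, C (n - 1 - (v : ℕ))).coeff k =
        if S.card = k then ∏ v ∈ Sᶜ, (n - 1 - (v : ℕ)) else 0 := by
    rw [Finset.prod_const, ← map_prod C, coeff_mul_C, coeff_X_pow, Finset.compl_eq_univ_sdiff]
    simp [eq_comm]
  rw [hrev, Finset.prod_add] at h
  simp only [finsetSum_coeff, hcoeff, coeff_X_pow, Finset.powerset_univ] at h
  rw [stirlingFirst, Nat.card_eq_fintype_card, Fintype.card_subtype, Finset.card_filter,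
    Finset.sum_filter, ← h]
  simp only [eq_comm]

section Forests

variable {n : ℕ}

/-- The vertices that are roots or have a smaller parent. -/
def ascendingVertices (p : Fin n → Option (Fin n)) : Finset (Fin n) :=
  Finset.univ.filter fun v => ∀ w, p v = some w → w < v

/-- The parents allowed for `v` in a unimodal forest whose ascending vertices form `S`. -/
def unimodalParents (S : Finset (Fin n)) (v : Fin n) : Finset (Option (Fin n)) :=
  if v ∈ S then (S.filter (· < v)).insertNone else (Finset.Ioi v).map Function.Embedding.some

theorem mem_ascendingVertices {p : Fin n → Option (Fin n)} {v : Fin n} :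
    v ∈ ascendingVertices p ↔ ∀ w, p v = some w → w < v := by
  simp [ascendingVertices]

theorem mem_piFinset_unimodalParents {p : Fin n → Option (Fin n)} {S : Finset (Fin n)} :
    p ∈ Fintype.piFinset (unimodalParents S) ↔
      (∀ v ∈ S, ∀ w, p v = some w → w ∈ S ∧ w < v) ∧ ∀ v ∉ S, ∃ w, p v = some w ∧ v < w := by
  rw [Fintype.mem_piFinset]
  constructor
  · refine fun h => ⟨fun v hv w hw => ?_, fun v hv => ?_⟩
    · have := h v
      rw [unimodalParents, if_pos hv, hw] at this
      simpa using this
    · have := h v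
      rw [unimodalParents, if_neg hv] at this
      simpa [and_comm, eq_comm] using this
  · rintro ⟨h1, h2⟩ v
    by_cases hv : v ∈ S
    · rw [unimodalParents, if_pos hv, Finset.mem_insertNone]
      intro w hw
      simpa using h1 v hv w hw
    · rw [unimodalParents, if_neg hv]
      simpa [and_comm, eq_comm] using h2 v hv

theorem ascendingVertices_eq_of_mem_piFinset {p : Fin n → Option (Fin n)} {S : Finset (Fin n)}
    (h : p ∈ Fintype.piFinset (unimodalParents S)) : ascendingVertices p = S := by
  rw [mem_piFinset_unimodalParents] at h
  ext v
  rw [mem_ascendingVertices]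
  refine ⟨fun hv => ?_, fun hv w hw => (h.1 v hv w hw).2⟩
  by_contra hvS
  obtain ⟨w, hw, hlt⟩ := h.2 v hvS
  exact lt_asymm hlt (hv w hw)

theorem isForest_of_mem_piFinset {p : Fin n → Option (Fin n)} {S : Finset (Fin n)}
    (h : p ∈ Fintype.piFinset (unimodalParents S)) : IsForest p := by
  rw [mem_piFinset_unimodalParents] at h
  refine ⟨fun v => if v ∈ S then v else n + (n - v), fun v w hvw => ?_⟩
  by_cases hv : v ∈ S
  · obtain ⟨hw, hlt⟩ := h.1 v hv w hvw
    simpa [hv, hw] using hlt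
  · obtain ⟨w', hw', hlt⟩ := h.2 v hv
    obtain rfl : w' = w := by simpa [hw'] using hvw
    by_cases hw : w' ∈ S
    · simp only [hv, hw, if_true, if_false]; omega
    · simp only [hv, hw, if_false]; omega

theorem StrictAnc.mem_and_lt {p : Fin n → Option (Fin n)} {S : Finset (Fin n)}
    (h : p ∈ Fintype.piFinset (unimodalParents S)) {a b : Fin n} (hab : StrictAnc p a b)
    (hb : b ∈ S) : a ∈ S ∧ a < b := by
  rw [mem_piFinset_unimodalParents] at h
  induction hab with
  | single hab => exact h.1 _ hb _ hab
  | tail _ hbc ih =>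
    obtain ⟨hm, hlt⟩ := h.1 _ hb _ hbc
    exact ⟨(ih hm).1, (ih hm).2.trans hlt⟩

theorem StrictAnc.notMem_and_lt {p : Fin n → Option (Fin n)} {S : Finset (Fin n)}
    (h : p ∈ Fintype.piFinset (unimodalParents S)) {a b : Fin n} (hab : StrictAnc p a b)
    (ha : a ∉ S) : b ∉ S ∧ b < a := by
  have step : ∀ x y, p y = some x → x ∉ S → y ∉ S ∧ y < x := by
    rw [mem_piFinset_unimodalParents] at h
    intro x y hxy hx
    have hy : y ∉ S := fun hy => hx (h.1 y hy x hxy).1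
    obtain ⟨w, hw, hlt⟩ := h.2 y hy
    obtain rfl : w = x := by simpa [hw] using hxy
    exact ⟨hy, hlt⟩
  induction hab with
  | single hab => exact step _ _ hab ha
  | tail _ hbc ih => exact ⟨(step _ _ hbc ih.1).1, (step _ _ hbc ih.1).2.trans ih.2⟩

theorem not_valley_of_mem_piFinset {p : Fin n → Option (Fin n)} {S : Finset (Fin n)}
    (h : p ∈ Fintype.piFinset (unimodalParents S)) {a b c : Fin n} (hab : StrictAnc p a b)
    (hbc : StrictAnc p b c) : ¬ (b < a ∧ b < c) := by
  rintro ⟨hba, hcb⟩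
  have hb : b ∉ S := fun hb => lt_asymm hba (hab.mem_and_lt h hb).2
  exact lt_asymm hcb (hbc.notMem_and_lt h hb).2

theorem forestContains_312_iff {p : Fin n → Option (Fin n)} :
    ForestContains p [3, 1, 2] ↔
      ∃ a b c, StrictAnc p a b ∧ StrictAnc p b c ∧ b < c ∧ c < a := by
  constructor
  · rintro ⟨u, hu, hlt⟩
    exact ⟨u 0, u 1, u 2, hu 0 1 (by decide), hu 1 2 (by decide),
      (hlt 1 2).1 (by decide), (hlt 2 0).1 (by decide)⟩
  · rintro ⟨a, b, c, hab, hbc, h1, h2⟩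
    have hac : StrictAnc p a c := Relation.TransGen.trans hab hbc
    refine ⟨![a, b, c], ?_, ?_⟩
    · intro i j hij
      fin_cases i <;> fin_cases j <;> first | exact absurd hij (by decide) | assumption
    · intro i j
      fin_cases i <;> fin_cases j <;> simp <;> order

theorem forestContains_213_iff {p : Fin n → Option (Fin n)} :
    ForestContains p [2, 1, 3] ↔
      ∃ a b c, StrictAnc p a b ∧ StrictAnc p b c ∧ b < a ∧ a < c := by
  constructor
  · rintro ⟨u, hu, hlt⟩
    exact ⟨u 0, u 1, u 2, hu 0 1 (by decide), hu 1 2 (by decide),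
      (hlt 1 0).1 (by decide), (hlt 0 2).1 (by decide)⟩
  · rintro ⟨a, b, c, hab, hbc, h1, h2⟩
    have hac : StrictAnc p a c := Relation.TransGen.trans hab hbc
    refine ⟨![a, b, c], ?_, ?_⟩
    · intro i j hij
      fin_cases i <;> fin_cases j <;> first | exact absurd hij (by decide) | assumption
    · intro i j
      fin_cases i <;> fin_cases j <;> simp <;> order

theorem isForest_and_avoids_iff {p : Fin n → Option (Fin n)} :
    (IsForest p ∧ ForestAvoids p [3, 1, 2] ∧ ForestAvoids p [2, 1, 3]) ↔
      p ∈ Fintype.piFinset (unimodalParents (ascendingVertices p)) := by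
  simp only [ForestAvoids, forestContains_312_iff, forestContains_213_iff]
  constructor
  · rintro ⟨⟨d, hd⟩, h312, h213⟩
    rw [mem_piFinset_unimodalParents]
    refine ⟨fun v hv w hw => ?_, fun v hv => ?_⟩
    · have hwv := mem_ascendingVertices.1 hv w hw
      refine ⟨mem_ascendingVertices.2 fun u hu => ?_, hwv⟩
      by_contra hle
      have hwu : w < u := lt_of_le_of_ne (not_lt.1 hle) fun h =>
        (hd w u hu).ne (by rw [h])
      have hvw : StrictAnc p w v := .single hw
      have huw : StrictAnc p u w := .single hu
      rcases lt_trichotomy v u with h | h | h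
      · exact h312 ⟨u, w, v, huw, hvw, hwv, h⟩
      · subst h
        exact lt_asymm (hd _ _ hw) (hd _ _ hu)
      · exact h213 ⟨u, w, v, huw, hvw, hwu, h⟩
    · rw [mem_ascendingVertices] at hv
      push Not at hv
      obtain ⟨w, hw, hle⟩ := hv
      exact ⟨w, hw, lt_of_le_of_ne hle fun h => (hd v w hw).ne (by rw [h])⟩
  · intro h
    refine ⟨isForest_of_mem_piFinset h, ?_, ?_⟩
    · rintro ⟨a, b, c, hab, hbc, h1, h2⟩
      exact not_valley_of_mem_piFinset h hab hbc ⟨h1.trans h2, h1⟩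
    · rintro ⟨a, b, c, hab, hbc, h1, h2⟩
      exact not_valley_of_mem_piFinset h hab hbc ⟨h1, h1.trans h2⟩

theorem prod_card_filter_lt_add_one {α : Type*} [LinearOrder α] (S : Finset α) :
    ∏ v ∈ S, ((S.filter (· < v)).card + 1) = S.card.factorial := by
  induction S using Finset.induction_on_max with
  | empty => simp
  | insert a s hmax ih =>
    have ha : a ∉ s := fun h => lt_irrefl a (hmax a h)
    rw [Finset.prod_insert ha, Finset.card_insert_of_notMem ha, Nat.factorial_succ, ← ih]
    congr 1
    · rw [Finset.filter_insert, if_neg (lt_irrefl a), Finset.filter_true_of_mem hmax]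
    · refine Finset.prod_congr rfl fun v hv => ?_
      rw [Finset.filter_insert, if_neg (lt_asymm (hmax v hv))]

theorem card_piFinset_unimodalParents (S : Finset (Fin n)) :
    (Fintype.piFinset (unimodalParents S)).card =
      S.card.factorial * ∏ v ∈ Sᶜ, (n - 1 - (v : ℕ)) := by
  rw [Fintype.card_piFinset, ← Finset.prod_mul_prod_compl S, ← prod_card_filter_lt_add_one]
  congr 1
  · refine Finset.prod_congr rfl fun v hv => ?_
    rw [unimodalParents, if_pos hv, Finset.card_insertNone]
  · refine Finset.prod_congr rfl fun v hv => ?_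
    rw [unimodalParents, if_neg (Finset.mem_compl.1 hv), Finset.card_map, Fin.card_Ioi]

theorem card_unimodal_forests_eq_sum (n : ℕ) :
    Nat.card {p : Fin n → Option (Fin n) //
        IsForest p ∧ ForestAvoids p [3, 1, 2] ∧ ForestAvoids p [2, 1, 3]} =
      ∑ S : Finset (Fin n), S.card.factorial * ∏ v ∈ Sᶜ, (n - 1 - (v : ℕ)) := by
  simp only [isForest_and_avoids_iff]
  rw [Nat.card_eq_fintype_card, Fintype.card_subtype,
    Finset.card_eq_sum_card_fiberwise (f := ascendingVertices) (t := Finset.univ) (by simp)]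
  refine Finset.sum_congr rfl fun S _ => ?_
  rw [← card_piFinset_unimodalParents]
  congr 1
  ext p
  simp only [Finset.mem_filter, Finset.mem_univ, true_and]
  constructor
  · rintro ⟨h, rfl⟩
    exact h
  · intro h
    have := ascendingVertices_eq_of_mem_piFinset h
    exact ⟨this.symm ▸ h, this⟩

end Forests

theorem stirlingFirst_zero_right {n : ℕ} (hn : 1 ≤ n) : stirlingFirst n 0 = 0 := by
  rw [stirlingFirst_eq_sum_prod]
  refine Finset.sum_eq_zero fun S hS => ?_
  have hS' : S = ∅ := by simpa using hS
  exact Finset.prod_eq_zero (i := ⟨n - 1, by omega⟩) (by simp [hS']) (by simp)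

theorem count_unimodal_forests (n : ℕ) (hn : 1 ≤ n) :
    Nat.card {p : Fin n → Option (Fin n) //
        IsForest p ∧ ForestAvoids p [3, 1, 2] ∧ ForestAvoids p [2, 1, 3]} =
    ∑ k ∈ Finset.Icc 1 n, k.factorial * stirlingFirst n k := by
  have hsub : Finset.Icc 1 n ⊆ Finset.range (n + 1) := fun k hk => by
    simp only [Finset.mem_Icc, Finset.mem_range] at *; omega
  rw [card_unimodal_forests_eq_sum, Finset.sum_subset hsub, ← Finset.sum_fiberwise_of_maps_to
    (s := Finset.univ) (t := Finset.range (n + 1)) (g := Finset.card)]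
  · refine Finset.sum_congr rfl fun k _ => ?_
    rw [stirlingFirst_eq_sum_prod, Finset.mul_sum]
    refine Finset.sum_congr rfl fun S hS => ?_
    rw [(Finset.mem_filter.1 hS).2]
  · intro S _
    simpa [Nat.lt_succ_iff] using S.card_le_univ
  · intro k hk hk'
    obtain rfl : k = 0 := by
      simp only [Finset.mem_Icc, Finset.mem_range] at *; omega
    rw [stirlingFirst_zero_right hn, mul_zero]
end

section
/- For all n ≥ 1, the number of rooted labeled forests on [n] avoiding all three patterns 312, 213, and 123 equals ∑_{k=1}^{n} B(k)·c(n,k), where B(k) is the k-th Bell number and c(n,k) is the unsigned Stirling number of the first kind. -/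
open Finset

/-- Every vertex other than a root is larger than all of its strict descendants. -/
def IsDecreasingBelowRoots {n : ℕ} (p : Fin n → Option (Fin n)) : Prop :=
  ∀ b v : Fin n, p b ≠ none → StrictAnc p b v → v < b

/-- The possible values at `v` of a parent function with root map `c` that decreases below its
roots. -/
def parentChoices {n : ℕ} (c : Fin n → Fin n) (v : Fin n) : Finset (Option (Fin n)) :=
  if c v = v then {none} else
    (univ.filter fun w => c w = c v ∧ (w = c v ∨ v < w)).map Function.Embedding.some

theorem mem_parentChoices_none {n : ℕ} {c : Fin n → Fin n} {v : Fin n} :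
    none ∈ parentChoices c v ↔ c v = v := by
  unfold parentChoices
  split_ifs with h <;> simp [h]

theorem mem_parentChoices_some {n : ℕ} {c : Fin n → Fin n} {v w : Fin n} :
    some w ∈ parentChoices c v ↔ c v ≠ v ∧ c w = c v ∧ (w = c v ∨ v < w) := by
  unfold parentChoices
  split_ifs with h <;> simp [h]

theorem StrictAnc.ne {n : ℕ} {p : Fin n → Option (Fin n)} (hp : IsForest p) {a b : Fin n}
    (h : StrictAnc p a b) : a ≠ b := by
  obtain ⟨d, hd⟩ := hp
  have : d a < d b := by
    induction h with
    | single h => exact hd _ _ h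
    | tail _ h ih => exact ih.trans (hd _ _ h)
  rintro rfl
  exact this.false

theorem forestContains_three {n : ℕ} {p : Fin n → Option (Fin n)} {x y z : ℕ} {a b v : Fin n}
    (hab : StrictAnc p a b) (hbv : StrictAnc p b v)
    (h : ∀ i j : Fin 3, ![x, y, z] i < ![x, y, z] j ↔ ![a, b, v] i < ![a, b, v] j) :
    ForestContains p [x, y, z] := by
  refine ⟨![a, b, v], ?_, ?_⟩
  · intro i j hij
    change Fin 3 at i j
    fin_cases i <;> fin_cases j <;> first
      | exact hab
      | exact hbv
      | exact Relation.TransGen.trans hab hbv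
      | exact absurd hij (show ¬ ((_ : Fin 3) < _) by decide)
  · intro i j
    change Fin 3 at i j
    convert h i j using 2 <;> (fin_cases i <;> fin_cases j <;> rfl)

theorem exists_root_map {n : ℕ} {p : Fin n → Option (Fin n)} (hp : IsForest p) :
    ∃ c : Fin n → Fin n, (∀ v, p (c v) = none) ∧
      (∀ v, Relation.ReflTransGen (fun x y : Fin n => p y = some x) (c v) v) ∧
      (∀ v, p v = none → c v = v) ∧ ∀ v w, p v = some w → c v = c w := by
  obtain ⟨d, hd⟩ := hp
  have ex : ∀ v, ∃ r, p r = none ∧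
      Relation.ReflTransGen (fun x y : Fin n => p y = some x) r v := by
    intro v
    induction hk : d v using Nat.strong_induction_on generalizing v with
    | _ k ih =>
      cases hv : p v with
      | none => exact ⟨v, hv, .refl⟩
      | some w =>
        obtain ⟨r, hr, hrw⟩ := ih _ (hk ▸ hd v w hv) w rfl
        exact ⟨r, hr, hrw.tail hv⟩
  have uniq : ∀ v r r', p r = none →
      Relation.ReflTransGen (fun x y : Fin n => p y = some x) r v → p r' = none →
      Relation.ReflTransGen (fun x y : Fin n => p y = some x) r' v → r = r' := by
    intro v
    induction hk : d v using Nat.strong_induction_on generalizing v with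
    | _ k ih =>
      intro r r' hr h hr' h'
      rcases h.cases_tail with rfl | ⟨w, hw, hwv⟩ <;>
        rcases h'.cases_tail with rfl | ⟨w', hw', hwv'⟩
      · rfl
      · simp_all
      · simp_all
      · obtain rfl : w = w' := by simpa [hwv] using hwv'
        exact ih _ (hk ▸ hd v w hwv) w rfl r r' hr hw hr' hw'
  choose c hc hcv using ex
  refine ⟨c, hc, hcv, fun v hv => uniq v _ _ (hc v) (hcv v) hv .refl, fun v w h => ?_⟩
  exact uniq v _ _ (hc v) (hcv v) (hc w) ((hcv w).tail h)

theorem avoids_iff_isDecreasingBelowRoots {n : ℕ} {p : Fin n → Option (Fin n)}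
    (hp : IsForest p) :
    (ForestAvoids p [3, 1, 2] ∧ ForestAvoids p [2, 1, 3] ∧ ForestAvoids p [1, 2, 3]) ↔
      IsDecreasingBelowRoots p := by
  constructor
  · rintro ⟨h1, h2, h3⟩ b v hb hbv
    obtain ⟨a, ha⟩ := Option.ne_none_iff_exists'.1 hb
    have hab : StrictAnc p a b := .single ha
    have n1 := hab.ne hp
    have n2 := hbv.ne hp
    have n3 := StrictAnc.ne hp (Relation.TransGen.trans hab hbv)
    by_contra hvb
    have hbv' : b < v := lt_of_le_of_ne (not_lt.1 hvb) n2
    rcases lt_or_gt_of_ne n1 with hlt | hgt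
    · refine h3 (forestContains_three hab hbv ?_)
      have := hlt.trans hbv'
      simp [Fin.forall_fin_succ, hlt, hbv', this, hlt.le, hbv'.le, this.le]
    · rcases lt_or_gt_of_ne n3 with hlt' | hgt'
      · refine h2 (forestContains_three hab hbv ?_)
        simp [Fin.forall_fin_succ, hgt, hbv', hlt', hgt.le, hbv'.le, hlt'.le]
      · refine h1 (forestContains_three hab hbv ?_)
        simp [Fin.forall_fin_succ, hgt, hbv', hgt', hgt.le, hbv'.le, hgt'.le]
  · intro h
    have key : ∀ x y z : ℕ, y < z → ForestAvoids p [x, y, z] := by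
      rintro x y z hyz ⟨u, hu, hσ⟩
      have h01 := hu (0 : Fin 3) (1 : Fin 3) Fin.zero_lt_one
      have h12 := hu (1 : Fin 3) (2 : Fin 3) (show (1 : Fin 3) < 2 by decide)
      have hlt := (hσ (1 : Fin 3) (2 : Fin 3)).1 hyz
      refine (h _ _ ?_ h12).asymm hlt
      obtain ⟨w, -, hw⟩ := Relation.TransGen.tail'_iff.1 h01
      exact fun h => by simp [hw] at h
    exact ⟨key _ _ _ (by decide), key _ _ _ (by decide), key _ _ _ (by decide)⟩

theorem exists_mem_parentChoices {n : ℕ} {p : Fin n → Option (Fin n)}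
    (hp : IsForest p) (h : IsDecreasingBelowRoots p) :
    ∃ c : Fin n → Fin n, (∀ v, c (c v) = c v) ∧ ∀ v, p v ∈ parentChoices c v := by
  obtain ⟨c, hc, hcv, hnone, hsome⟩ := exists_root_map hp
  refine ⟨c, fun v => hnone _ (hc v), fun v => ?_⟩
  cases hv : p v with
  | none => exact mem_parentChoices_none.2 (hnone v hv)
  | some w =>
    refine mem_parentChoices_some.2 ⟨fun e => ?_, (hsome v w hv).symm, ?_⟩
    · have := hc v
      simp [e, hv] at this
    · cases hw : p w with
      | none => exact .inl (by rw [hsome v w hv, hnone w hw])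
      | some x => exact .inr (h w v (by simp [hw]) (.single hv))

theorem isForest_of_mem_parentChoices {n : ℕ} {p : Fin n → Option (Fin n)} {c : Fin n → Fin n}
    (h : ∀ v, p v ∈ parentChoices c v) : IsForest p := by
  refine ⟨fun v => if c v = v then 0 else n - v, fun v w hvw => ?_⟩
  have := h v
  rw [hvw, mem_parentChoices_some] at this
  obtain ⟨h1, h2, rfl | h3⟩ := this
  · simp only [h1, h2]
    simp
  · simp only [h1, if_false]
    split_ifs <;> omega

theorem isDecreasingBelowRoots_of_mem_parentChoices {n : ℕ} {p : Fin n → Option (Fin n)}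
    {c : Fin n → Fin n} (hc : ∀ v, c (c v) = c v) (h : ∀ v, p v ∈ parentChoices c v) :
    IsDecreasingBelowRoots p := by
  have step : ∀ b v : Fin n, p b ≠ none → p v = some b → v < b := by
    intro b v hb hv
    have := h v
    rw [hv, mem_parentChoices_some] at this
    obtain ⟨-, -, rfl | h3⟩ := this
    · obtain ⟨w, hw⟩ := Option.ne_none_iff_exists'.1 hb
      have := h (c v)
      rw [hw, mem_parentChoices_some] at this
      exact absurd (hc v) this.1
    · exact h3
  intro b v hb hbv
  induction hbv with
  | single hv => exact step _ _ hb hv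
  | tail hx hv ih =>
    refine (step _ _ ?_ hv).trans ih
    obtain ⟨w, -, hw⟩ := Relation.TransGen.tail'_iff.1 hx
    simp [hw]

theorem root_map_unique {n : ℕ} {p : Fin n → Option (Fin n)} (hp : IsForest p)
    {c c' : Fin n → Fin n} (h : ∀ v, p v ∈ parentChoices c v)
    (h' : ∀ v, p v ∈ parentChoices c' v) : c = c' := by
  obtain ⟨d, hd⟩ := hp
  funext v
  induction hk : d v using Nat.strong_induction_on generalizing v with
  | _ k ih =>
    have h1 := h v
    have h2 := h' v
    cases hv : p v with
    | none =>
      rw [hv, mem_parentChoices_none] at h1 h2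
      rw [h1, h2]
    | some w =>
      rw [hv, mem_parentChoices_some] at h1 h2
      rw [← h1.2.1, ← h2.2.1]
      exact ih _ (hk ▸ hd v w hv) w rfl

theorem card_avoiding_eq_sum_root_maps (n : ℕ) :
    Nat.card {p : Fin n → Option (Fin n) //
        IsForest p ∧ ForestAvoids p [3, 1, 2] ∧ ForestAvoids p [2, 1, 3] ∧
        ForestAvoids p [1, 2, 3]} =
    ∑ c : {c : Fin n → Fin n // ∀ v, c (c v) = c v}, ∏ v, #(parentChoices c.1 v) := by
  let f : (Σ c : {c : Fin n → Fin n // ∀ v, c (c v) = c v},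
        {p // p ∈ Fintype.piFinset (parentChoices c.1)}) →
      {p : Fin n → Option (Fin n) //
        IsForest p ∧ ForestAvoids p [3, 1, 2] ∧ ForestAvoids p [2, 1, 3] ∧
        ForestAvoids p [1, 2, 3]} := fun x =>
    have h := Fintype.mem_piFinset.1 x.2.2
    have hp := isForest_of_mem_parentChoices h
    ⟨x.2.1, hp, (avoids_iff_isDecreasingBelowRoots hp).2
      (isDecreasingBelowRoots_of_mem_parentChoices x.1.2 h)⟩
  have hf : f.Bijective := by
    constructor
    · rintro ⟨⟨c, hc⟩, p, hp⟩ ⟨⟨c', hc'⟩, p', hp'⟩ h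
      obtain rfl : p = p' := congrArg Subtype.val h
      obtain rfl : c = c' := root_map_unique
        (isForest_of_mem_parentChoices (Fintype.mem_piFinset.1 hp))
        (Fintype.mem_piFinset.1 hp) (Fintype.mem_piFinset.1 hp')
      rfl
    · rintro ⟨p, hp, ha⟩
      obtain ⟨c, hc, h⟩ := exists_mem_parentChoices hp
        ((avoids_iff_isDecreasingBelowRoots hp).1 ha)
      exact ⟨⟨⟨c, hc⟩, p, Fintype.mem_piFinset.2 h⟩, rfl⟩
  rw [← Nat.card_congr (Equiv.ofBijective f hf), Nat.card_eq_fintype_card, Fintype.card_sigma]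
  simp only [Fintype.card_coe, Fintype.card_piFinset]

theorem prod_card_filter_gt_succ {α : Type*} [LinearOrder α] (s : Finset α) :
    ∏ v ∈ s, (#{w ∈ s | v < w} + 1) = (#s).factorial := by
  induction s using Finset.induction_on_min with
  | empty => simp
  | insert a s ha ih =>
    have ha' : a ∉ s := fun h => (ha a h).false
    rw [prod_insert ha', card_insert_of_notMem ha', Nat.factorial_succ, ← ih]
    congr 1
    · congr 2
      ext x
      simp only [mem_filter, mem_insert]
      constructor
      · rintro ⟨rfl | h, h'⟩
        · exact absurd h' (lt_irrefl _)
        · exact h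
      · exact fun h => ⟨.inr h, ha x h⟩
    · refine prod_congr rfl fun v hv => ?_
      rw [filter_insert, if_neg (ha v hv).not_gt]

theorem prod_card_parentChoices_fiber {n : ℕ} (c : Fin n → Fin n) (r : Fin n) (hr : c r = r) :
    ∏ v with c v = r, #(parentChoices c v) = (#{v | c v = r} - 1).factorial := by
  have hmem : r ∈ ({v | c v = r} : Finset (Fin n)) := by simpa using hr
  rw [← mul_prod_erase _ _ hmem, ← card_erase_of_mem hmem, ← prod_card_filter_gt_succ]
  have h1 : #(parentChoices c r) = 1 := by simp [parentChoices, hr]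
  rw [h1, one_mul]
  refine prod_congr rfl fun v hv => ?_
  simp only [mem_erase, mem_filter, mem_univ, true_and] at hv
  obtain ⟨hvr, hcv⟩ := hv
  rw [parentChoices, if_neg (by rw [hcv]; exact hvr.symm), card_map, hcv,
    ← card_insert_of_notMem (a := r) (by simp)]
  congr 1
  ext w
  simp only [mem_filter, mem_univ, true_and, mem_insert, mem_erase]
  by_cases hw : w = r
  · simp [hw, hr]
  · simp [hw]

theorem sum_root_maps_eq_sum_setoid (n : ℕ) [Fintype (Setoid (Fin n))] :
    ∑ c : {c : Fin n → Fin n // ∀ v, c (c v) = c v}, ∏ v, #(parentChoices c.1 v) =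
    ∑ s : Setoid (Fin n), Nat.card {π : Equiv.Perm (Fin n) // ∀ x, s (π x) x} := by
  classical
  let f : (Σ s : Setoid (Fin n), ∀ q : Quotient s, {x : Fin n // Quotient.mk s x = q}) →
      {c : Fin n → Fin n // ∀ v, c (c v) = c v} := fun x =>
    ⟨fun v => x.2 (Quotient.mk _ v), fun v => congrArg (fun q => (x.2 q : Fin n)) (x.2 _).2⟩
  have hrel : ∀ x v w, x.1 v w ↔ (f x).1 v = (f x).1 w := by
    intro x v w
    rw [← Quotient.eq]
    refine ⟨fun h => congrArg (fun q => (x.2 q : Fin n)) h, fun h => ?_⟩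
    rw [← (x.2 (Quotient.mk _ v)).2, ← (x.2 (Quotient.mk _ w)).2]
    exact congrArg _ h
  have hf : f.Bijective := by
    constructor
    · rintro ⟨s, r⟩ ⟨s', r'⟩ h
      obtain rfl : s = s' := by
        ext v w
        exact (hrel ⟨s, r⟩ v w).trans (h ▸ (hrel ⟨s', r'⟩ v w).symm)
      congr 1
      funext q
      obtain ⟨v, rfl⟩ := Quotient.exists_rep q
      exact Subtype.ext (congrFun (congrArg Subtype.val h) v)
    · rintro ⟨c, hc⟩
      refine ⟨⟨Setoid.ker c, fun q => ⟨Quotient.lift c (fun _ _ h => h) q, ?_⟩⟩, rfl⟩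
      obtain ⟨v, rfl⟩ := Quotient.exists_rep q
      exact Quotient.sound (hc v)
  rw [← (Equiv.ofBijective f hf).sum_comp, Fintype.sum_sigma]
  refine sum_congr rfl fun s _ => ?_
  have hcard : ∀ q : Quotient s, 0 < Fintype.card {x : Fin n // Quotient.mk s x = q} := by
    intro q
    obtain ⟨v, rfl⟩ := Quotient.exists_rep q
    exact Fintype.card_pos_iff.2 ⟨⟨v, rfl⟩⟩
  have hprod : ∀ r : (∀ q : Quotient s, {x : Fin n // Quotient.mk s x = q}),
      ∏ v, #(parentChoices (Equiv.ofBijective f hf ⟨s, r⟩).1 v) =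
      ∏ q : Quotient s, (Fintype.card {x : Fin n // Quotient.mk s x = q} - 1).factorial := by
    intro r
    rw [← prod_fiberwise (g := Quotient.mk s)]
    refine prod_congr rfl fun q _ => ?_
    have hq : ∀ v, Quotient.mk s v = q ↔ (f ⟨s, r⟩).1 v = r q := by
      intro v
      refine ⟨fun h => congrArg (fun q => (r q : Fin n)) h, fun h => ?_⟩
      rw [← (r q).2, ← h]
      exact (r _).2.symm
    rw [Fintype.card_subtype]
    simp only [hq]
    exact prod_card_parentChoices_fiber _ _ ((hq _).1 (r q).2)
  rw [sum_congr rfl fun r _ => hprod r, sum_const, card_univ, Fintype.card_pi, smul_eq_mul,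
    ← prod_mul_distrib]
  rw [prod_congr rfl fun q _ => Nat.mul_factorial_pred (hcard q).ne',
    ← DomMulAct.stabilizer_card, ← Nat.card_eq_fintype_card]
  refine Nat.card_congr (Equiv.subtypeEquivRight fun π => ?_)
  simp only [funext_iff, Function.comp_apply, Quotient.eq]

theorem card_finpartition_eq_card_setoid (α : Type*) [Fintype α] [DecidableEq α] :
    Nat.card (Finpartition (univ : Finset α)) = Nat.card (Setoid α) := by
  classical
  refine (Nat.card_congr (Equiv.ofBijective
    (fun s : Setoid α => Finpartition.ofSetoid s) ⟨fun s t h => ?_, fun P => ?_⟩)).symm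
  · ext a b
    rw [← Finpartition.mem_part_ofSetoid_iff_rel, ← Finpartition.mem_part_ofSetoid_iff_rel]
    exact iff_of_eq (congrArg (fun P : Finpartition univ => b ∈ P.part a) h)
  · let s : Setoid α := Setoid.ker P.part
    refine ⟨s, ?_⟩
    have hpart : ∀ a, (Finpartition.ofSetoid s).part a = P.part a := by
      intro a
      ext b
      rw [Finpartition.mem_part_ofSetoid_iff_rel, Setoid.ker_def,
        eq_comm, P.mem_part_iff_part_eq_part (mem_univ _) (mem_univ _)]
    have himage : ∀ Q : Finpartition (univ : Finset α), Q.parts = univ.image Q.part := by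
      intro Q
      ext t
      simp only [mem_image, mem_univ, true_and]
      constructor
      · intro ht
        obtain ⟨a, ha⟩ := Q.nonempty_of_mem_parts ht
        exact ⟨a, Q.part_eq_of_mem ht ha⟩
      · rintro ⟨a, rfl⟩
        exact Q.part_mem.2 (mem_univ a)
    ext1
    rw [himage, himage P]
    simp [funext hpart]

theorem card_setoid_congr {α β : Type*} (e : α ≃ β) :
    Nat.card (Setoid α) = Nat.card (Setoid β) := by
  refine Nat.card_congr ⟨fun s => s.comap e.symm, fun s => s.comap e, fun s => ?_, fun s => ?_⟩ <;>
    ext <;> simp [Setoid.comap_rel]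

theorem card_quotient_sameCycle {n : ℕ} (π : Equiv.Perm (Fin n)) :
    Nat.card (Quotient (Equiv.Perm.SameCycle.setoid π)) = permNumCycles π := by
  classical
  let f : Fin n → π.cycleFactorsFinset ⊕ {x // x ∈ univ.filter fun x => π x = x} := fun x =>
    if h : π x = x then .inr ⟨x, by simpa using h⟩
    else .inl ⟨π.cycleOf x, by simpa [Equiv.Perm.cycleOf_mem_cycleFactorsFinset_iff] using h⟩
  have hsurj : f.Surjective := by
    rintro (⟨g, hg⟩ | ⟨x, hx⟩)
    · obtain ⟨x, hx⟩ := (Equiv.Perm.mem_cycleFactorsFinset_iff.1 hg).1.nonempty_support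
      have hgx := Equiv.Perm.cycle_is_cycleOf hx hg
      have hx' : π x ≠ x := by
        have := (Equiv.Perm.mem_cycleFactorsFinset_iff.1 hg).2 x hx
        rw [← this]
        exact Equiv.Perm.mem_support.1 hx
      exact ⟨x, by simp [f, hx', hgx]⟩
    · exact ⟨x, dif_pos (by simpa using hx)⟩
  have hker : Setoid.ker f = Equiv.Perm.SameCycle.setoid π := by
    ext x y
    rw [Setoid.ker_def]
    change _ ↔ π.SameCycle x y
    by_cases hx : π x = x
    · have h1 : π.SameCycle x y ↔ x = y :=
        ⟨fun h => h.eq_of_left hx, fun h => h ▸ .refl _ _⟩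
      rw [h1]
      by_cases hy : π y = y
      · simp [f, hx, hy]
      · simp only [f, hx, hy, dite_true, dite_false, reduceCtorEq, false_iff]
        rintro rfl
        exact hy hx
    · by_cases hy : π y = y
      · simp only [f, hx, hy, dite_true, dite_false, reduceCtorEq, false_iff]
        intro h
        exact hx (h.eq_of_right hy ▸ hy)
      · simp only [f, hx, hy, dite_false, Sum.inl.injEq, Subtype.mk.injEq]
        refine ⟨fun h => ?_, fun h => h.cycleOf_eq⟩
        have h2 : y ∈ (π.cycleOf x).support := by
          rw [h, Equiv.Perm.mem_support_cycleOf_iff]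
          exact ⟨.refl _ _, by simpa using hy⟩
        exact (Equiv.Perm.mem_support_cycleOf_iff.1 h2).1
  rw [← hker, Nat.card_congr (Setoid.quotientKerEquivOfSurjective f hsurj), Nat.card_sum,
    permNumCycles, Equiv.Perm.cycleType_def, Nat.card_eq_fintype_card, Nat.card_eq_fintype_card,
    Fintype.card_coe, Fintype.card_coe, Multiset.card_map, Finset.card_def]

theorem bellNumber_permNumCycles {n : ℕ} (π : Equiv.Perm (Fin n)) :
    bellNumber (permNumCycles π) = Nat.card {s : Setoid (Fin n) // ∀ x, s (π x) x} := by
  have e : Fin (permNumCycles π) ≃ Quotient (Equiv.Perm.SameCycle.setoid π) :=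
    (finCongr (card_quotient_sameCycle π).symm).trans (Finite.equivFin _).symm
  rw [bellNumber, card_finpartition_eq_card_setoid, card_setoid_congr e,
    ← Nat.card_congr (Setoid.correspondence _).toEquiv]
  refine Nat.card_congr (Equiv.subtypeEquivRight fun s => ⟨fun h x => ?_, fun h x y hxy => ?_⟩)
  · exact s.symm' (h (Equiv.Perm.sameCycle_apply_right.2 (.refl π x)))
  · obtain ⟨i, -, rfl⟩ := Equiv.Perm.SameCycle.exists_pow_eq' (show π.SameCycle x y from hxy)
    refine s.symm' ?_
    clear hxy
    induction i with
    | zero => exact s.refl' x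
    | succ i ih =>
      rw [pow_succ', Equiv.Perm.mul_apply]
      exact s.trans' (h _) ih

theorem sum_bellNumber_mul_stirlingFirst (n : ℕ) (hn : 1 ≤ n) :
    ∑ k ∈ Finset.Icc 1 n, bellNumber k * stirlingFirst n k =
      ∑ π : Equiv.Perm (Fin n), bellNumber (permNumCycles π) := by
  classical
  have hmem : ∀ π ∈ (univ : Finset (Equiv.Perm (Fin n))), permNumCycles π ∈ Icc 1 n := by
    intro π _
    rw [← card_quotient_sameCycle, mem_Icc]
    have hsurj := Quotient.mk_surjective (s := Equiv.Perm.SameCycle.setoid π)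
    have : Nonempty (Quotient (Equiv.Perm.SameCycle.setoid π)) := ⟨Quotient.mk _ ⟨0, hn⟩⟩
    exact ⟨Nat.card_pos, by simpa using Nat.card_le_card_of_surjective _ hsurj⟩
  rw [← sum_fiberwise_of_maps_to hmem]
  refine sum_congr rfl fun k _ => ?_
  rw [sum_congr rfl (g := fun _ => bellNumber k) fun π hπ => by rw [(mem_filter.1 hπ).2],
    sum_const, smul_eq_mul, mul_comm, stirlingFirst, Nat.card_eq_fintype_card,
    Fintype.card_subtype]

theorem count_forests_avoiding_312_213_123 (n : ℕ) (hn : 1 ≤ n) :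
    Nat.card {p : Fin n → Option (Fin n) //
        IsForest p ∧ ForestAvoids p [3, 1, 2] ∧ ForestAvoids p [2, 1, 3] ∧
        ForestAvoids p [1, 2, 3]} =
    ∑ k ∈ Finset.Icc 1 n, bellNumber k * stirlingFirst n k := by
  classical
  have : Finite (Setoid (Fin n)) :=
    Finite.of_injective (fun s : Setoid (Fin n) => (s : Fin n → Fin n → Prop))
      fun s t h => Setoid.ext fun a b => iff_of_eq (congrFun (congrFun h a) b)
  have := Fintype.ofFinite (Setoid (Fin n))
  rw [card_avoiding_eq_sum_root_maps, sum_root_maps_eq_sum_setoid,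
    sum_bellNumber_mul_stirlingFirst n hn]
  simp only [bellNumber_permNumCycles, Nat.card_eq_fintype_card, Fintype.card_subtype]
  exact sum_card_bipartiteAbove_eq_sum_card_bipartiteBelow
    fun (s : Setoid (Fin n)) (π : Equiv.Perm (Fin n)) => ∀ x, s (π x) x
end
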